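/- The characteristic function of the Dirichlet distribution Dir(α), α ∈ ℝ_{>0}^k, satisfies ∫_{Δ^{k-1}} exp(i s·y) dDir(α)(y) = Σ_{m ∈ ℕ_0^k} ((α)_m / m!) · (i^{|m|} s^m) / (|α|)_{|m|}, i.e. it equals the confluent Lauricella (Humbert) function Φ_2[α; |α|; i s]. -/

import Mathlib

open MeasureTheory
open scoped Classical

/-- The Dirichlet distribution with parameter `α ∈ ℝ^{k+1}` on the standard simplex
`Δ^k ⊂ ℝ^{k+1}`, realized as the image under `z ↦ (z, 1 - Σz)` of the measure on the
corner simplex with density `y^{α-1}/B(α)` with respect to Lebesgue measure. -/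
noncomputable def dirichlet {k : ℕ} (α : Fin (k + 1) → ℝ) :
    Measure (Fin (k + 1) → ℝ) :=
  Measure.map (fun z : Fin k → ℝ => Fin.snoc z (1 - ∑ i, z i))
    ((volume : Measure (Fin k → ℝ)).withDensity fun z =>
      ENNReal.ofReal <|
        if (∀ i, 0 ≤ z i) ∧ ∑ i, z i ≤ 1 then
          (Real.Gamma (∑ i, α i) / ∏ i, Real.Gamma (α i)) *
            (∏ i : Fin k, z i ^ (α i.castSucc - 1)) * (1 - ∑ i, z i) ^ (α (Fin.last k) - 1)
        else 0)

/-- A finite product of absolutely convergent series is the sum of the products over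
multi-indices. -/
theorem hasSum_prod_fin {n : ℕ} {f : Fin n → ℕ → ℂ} (hf : ∀ i, Summable fun j => ‖f i j‖) :
    Summable (fun m : Fin n → ℕ => ‖∏ i, f i (m i)‖) ∧
      HasSum (fun m : Fin n → ℕ => ∏ i, f i (m i)) (∏ i, ∑' j, f i j) := by
  induction n with
  | zero =>
    refine ⟨(hasSum_fintype _).summable, ?_⟩
    convert hasSum_fintype (fun m : Fin 0 → ℕ => ∏ i, f i (m i)) using 1
    simp
  | succ n ih =>
    obtain ⟨hs, hS⟩ := ih (f := fun i => f i.succ) fun i => hf i.succ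
    have hcomp : ∀ p : ℕ × (Fin n → ℕ), ∏ i, f i ((Fin.consEquiv fun _ => ℕ) p i) =
        f 0 p.1 * ∏ i : Fin n, f i.succ (p.2 i) := fun p => by
      simp [Fin.prod_univ_succ, Fin.consEquiv]
    have hn := (hf 0).mul_norm hs
    constructor
    · rw [← (Fin.consEquiv fun _ => ℕ).summable_iff]
      simpa only [Function.comp_def, hcomp] using hn
    · rw [← (Fin.consEquiv fun _ => ℕ).hasSum_iff]
      simp only [Function.comp_def, hcomp]
      rw [Fin.prod_univ_succ, ← hS.tsum_eq, tsum_mul_tsum_of_summable_norm (hf 0) hs]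
      exact hn.of_norm.hasSum

theorem Real.Gamma_add_natCast_eq {x : ℝ} (hx : 0 < x) (n : ℕ) :
    Real.Gamma (x + n) = (ascPochhammer ℝ n).eval x * Real.Gamma x := by
  induction n with
  | zero => simp
  | succ n ih =>
    rw [Nat.cast_succ, ← add_assoc, Real.Gamma_add_one (by positivity), ih,
      ascPochhammer_succ_eval]
    ring

/-- The Beta integral over `[0, a]`. -/
theorem lintegral_rpow_mul_sub_rpow {s t a : ℝ} (hs : 0 < s) (ht : 0 < t) (ha : 0 < a) :
    ∫⁻ x in Set.Ioo 0 a, ENNReal.ofReal (x ^ (s - 1) * (a - x) ^ (t - 1)) =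
      ENNReal.ofReal (Real.Gamma s * Real.Gamma t / Real.Gamma (s + t) * a ^ (s + t - 1)) := by
  have hΓs := Real.Gamma_pos_of_pos hs
  have hΓt := Real.Gamma_pos_of_pos ht
  have hΓst := Real.Gamma_pos_of_pos (add_pos hs ht)
  have hC : (∫ x in Set.Ioc 0 a, ((x ^ (s - 1) * (a - x) ^ (t - 1) : ℝ) : ℂ)) =
      ((Real.Gamma s * Real.Gamma t / Real.Gamma (s + t) * a ^ (s + t - 1) : ℝ) : ℂ) := by
    have h := Complex.betaIntegral_scaled s t ha
    rw [intervalIntegral.integral_of_le ha.le,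
      Complex.betaIntegral_eq_Gamma_mul_div _ _ (by simpa) (by simpa)] at h
    rw [setIntegral_congr_fun (g := fun x : ℝ => (x : ℂ) ^ ((s : ℂ) - 1) *
      ((a : ℂ) - x) ^ ((t : ℂ) - 1)) measurableSet_Ioc, h]
    · push_cast [Complex.ofReal_cpow ha.le, ← Complex.Gamma_ofReal]
      ring
    · intro x hx
      simp only
      push_cast [Complex.ofReal_cpow hx.1.le, Complex.ofReal_cpow (sub_nonneg.2 hx.2)]
      rfl
  have hR : (∫ x in Set.Ioc 0 a, x ^ (s - 1) * (a - x) ^ (t - 1)) =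
      Real.Gamma s * Real.Gamma t / Real.Gamma (s + t) * a ^ (s + t - 1) := by
    rw [integral_complex_ofReal] at hC
    exact_mod_cast hC
  have hint : IntegrableOn (fun x => x ^ (s - 1) * (a - x) ^ (t - 1)) (Set.Ioc 0 a) := by
    refine not_imp_comm.1 integral_undef ?_
    rw [hR]
    positivity
  rw [Measure.restrict_congr_set Ioo_ae_eq_Ioc, ← hR]
  refine (ofReal_integral_eq_lintegral_ofReal hint ?_).symm
  refine (ae_restrict_iff' measurableSet_Ioc).2 (.of_forall fun x hx => ?_)
  exact mul_nonneg (Real.rpow_nonneg hx.1.le _) (Real.rpow_nonneg (sub_nonneg.2 hx.2) _)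

/-- The unnormalized Dirichlet density on the corner simplex of size `T`. -/
noncomputable def cornerDensity {k : ℕ} (β : Fin k → ℝ) (b T : ℝ) (z : Fin k → ℝ) : ℝ :=
  if (∀ i, 0 ≤ z i) ∧ ∑ i, z i ≤ T then
    (∏ i, z i ^ (β i - 1)) * (T - ∑ i, z i) ^ (b - 1)
  else 0

theorem measurable_cornerDensity {k : ℕ} (β : Fin k → ℝ) (b T : ℝ) :
    Measurable (cornerDensity β b T) := by
  unfold cornerDensity
  have h : MeasurableSet {z : Fin k → ℝ | ∀ i, 0 ≤ z i} := by
    simp only [Set.ofPred_forall]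
    exact MeasurableSet.iInter fun i => measurableSet_le measurable_const (measurable_pi_apply i)
  exact Measurable.ite (h.inter
    (measurableSet_le (f := fun z : Fin k → ℝ => ∑ i, z i) (by fun_prop) measurable_const))
    (by fun_prop) measurable_const

theorem cornerDensity_nonneg {k : ℕ} (β : Fin k → ℝ) (b T : ℝ) (z : Fin k → ℝ) :
    0 ≤ cornerDensity β b T z := by
  unfold cornerDensity
  split_ifs with h
  · exact mul_nonneg (Finset.prod_nonneg fun i _ => Real.rpow_nonneg (h.1 i) _)
      (Real.rpow_nonneg (sub_nonneg.2 h.2) _)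
  · exact le_rfl

theorem cornerDensity_cons {k : ℕ} (β : Fin (k + 1) → ℝ) (b T : ℝ) {t : ℝ} (ht : 0 ≤ t)
    (w : Fin k → ℝ) :
    cornerDensity β b T (Fin.cons t w) =
      t ^ (β 0 - 1) * cornerDensity (fun i => β i.succ) b (T - t) w := by
  simp only [cornerDensity, Fin.forall_fin_succ, Fin.sum_univ_succ, Fin.prod_univ_succ,
    Fin.cons_zero, Fin.cons_succ, ht, true_and, le_sub_iff_add_le', mul_ite, mul_zero]
  split_ifs
  · rw [sub_sub, mul_assoc]
  · rfl

theorem cornerDensity_cons_eq_zero {k : ℕ} (β : Fin (k + 1) → ℝ) (b T : ℝ) {t : ℝ}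
    (ht : t ∉ Set.Icc 0 T) (w : Fin k → ℝ) : cornerDensity β b T (Fin.cons t w) = 0 := by
  refine if_neg fun h => ht ⟨by simpa using h.1 0, ?_⟩
  have h2 := h.2
  rw [Fin.sum_univ_succ] at h2
  have h3 : 0 ≤ ∑ i : Fin k, (Fin.cons t w : Fin (k + 1) → ℝ) i.succ :=
    Finset.sum_nonneg fun i _ => h.1 i.succ
  simp only [Fin.cons_zero] at h2
  linarith

/-- The Dirichlet integral over the corner simplex of size `T`. -/
theorem lintegral_cornerDensity {k : ℕ} {β : Fin k → ℝ} (hβ : ∀ i, 0 < β i) {b T : ℝ}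
    (hb : 0 < b) (hT : 0 < T) :
    ∫⁻ z, ENNReal.ofReal (cornerDensity β b T z) =
      ENNReal.ofReal ((∏ i, Real.Gamma (β i)) * Real.Gamma b / Real.Gamma (∑ i, β i + b) *
        T ^ (∑ i, β i + b - 1)) := by
  induction k generalizing T with
  | zero =>
    have h := Real.Gamma_pos_of_pos hb
    rw [volume_pi, Measure.pi_of_empty, lintegral_dirac]
    simp [cornerDensity, hT.le, h.ne']
  | succ k ih =>
    set σ := ∑ i : Fin k, β i.succ with hσ
    have hσb : 0 < σ + b := add_pos_of_nonneg_of_pos (Finset.sum_nonneg fun i _ => (hβ _).le) hb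
    set c := (∏ i : Fin k, Real.Gamma (β i.succ)) * Real.Gamma b / Real.Gamma (σ + b) with hc
    have hc0 : 0 ≤ c := by
      have := Real.Gamma_pos_of_pos hb
      have := Real.Gamma_pos_of_pos hσb
      have := Finset.prod_nonneg fun (i : Fin k) (_ : i ∈ Finset.univ) =>
        (Real.Gamma_pos_of_pos (hβ i.succ)).le
      positivity
    have hmp := (volume_preserving_piFinSuccAbove (fun _ : Fin (k + 1) => ℝ) 0).symm
    have hcons : ∀ p : ℝ × (Fin k → ℝ),
        (MeasurableEquiv.piFinSuccAbove (fun _ : Fin (k + 1) => ℝ) 0).symm p =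
          Fin.cons p.1 p.2 := fun p => by
      simp [MeasurableEquiv.piFinSuccAbove, Fin.insertNthEquiv]
    have hmeas := (measurable_cornerDensity β b T).ennreal_ofReal
    rw [← hmp.lintegral_comp hmeas, Measure.volume_eq_prod,
      lintegral_prod (fun p => ENNReal.ofReal (cornerDensity β b T
        ((MeasurableEquiv.piFinSuccAbove (fun _ : Fin (k + 1) => ℝ) 0).symm p)))
        (hmeas.comp hmp.measurable).aemeasurable]
    simp only [hcons]
    have hae : ∀ᵐ t : ℝ, ∫⁻ w : Fin k → ℝ, ENNReal.ofReal (cornerDensity β b T (Fin.cons t w)) =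
        (Set.Ioo 0 T).indicator (fun t => ENNReal.ofReal c *
          ENNReal.ofReal (t ^ (β 0 - 1) * (T - t) ^ (σ + b - 1))) t := by
      filter_upwards [Measure.ae_ne volume 0, Measure.ae_ne volume T] with t ht0 htT
      by_cases ht : t ∈ Set.Ioo 0 T
      · have hp : 0 ≤ t ^ (β 0 - 1) := Real.rpow_nonneg ht.1.le _
        rw [Set.indicator_of_mem ht]
        simp only [cornerDensity_cons β b T ht.1.le, ENNReal.ofReal_mul hp]
        rw [lintegral_const_mul _ (measurable_cornerDensity _ _ _).ennreal_ofReal,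
          ih (fun i => hβ i.succ) (sub_pos.2 ht.2), ← hσ, ← hc, ENNReal.ofReal_mul hc0]
        ring
      · rw [Set.indicator_of_notMem ht]
        have : t ∉ Set.Icc 0 T := fun h =>
          ht ⟨lt_of_le_of_ne h.1 (Ne.symm ht0), lt_of_le_of_ne h.2 htT⟩
        simp [cornerDensity_cons_eq_zero β b T this]
    rw [lintegral_congr_ae hae, lintegral_indicator measurableSet_Ioo,
      lintegral_const_mul _ (by fun_prop), lintegral_rpow_mul_sub_rpow (hβ 0) hσb hT,
      ← ENNReal.ofReal_mul hc0, Fin.prod_univ_succ, Fin.sum_univ_succ, ← hσ, hc]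
    have := (Real.Gamma_pos_of_pos hσb).ne'
    congr 1
    rw [add_assoc]
    field_simp

theorem measurable_snoc_one_sub_sum {k : ℕ} : Measurable fun z : Fin k → ℝ =>
    (Fin.snoc z (1 - ∑ i, z i) : Fin (k + 1) → ℝ) := by
  refine measurable_pi_iff.2 fun i => ?_
  refine Fin.lastCases ?_ (fun i => ?_) i
  · simp only [Fin.snoc_last]; fun_prop
  · simp only [Fin.snoc_castSucc]; fun_prop

theorem dirichlet_eq {k : ℕ} {α : Fin (k + 1) → ℝ} :
    dirichlet α = Measure.map (fun z : Fin k → ℝ => Fin.snoc z (1 - ∑ i, z i))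
      ((volume : Measure (Fin k → ℝ)).withDensity fun z =>
        ENNReal.ofReal (Real.Gamma (∑ i, α i) / (∏ i, Real.Gamma (α i)) *
          cornerDensity (fun i => α i.castSucc) (α (Fin.last k)) 1 z)) := by
  simp only [dirichlet, cornerDensity, mul_ite, mul_zero, mul_assoc]

theorem Real.rpow_sub_one_mul_pow {x a : ℝ} (hx : 0 ≤ x) (ha : 0 < a) (n : ℕ) :
    x ^ (a - 1) * x ^ n = x ^ (a + n - 1) := by
  rcases Nat.eq_zero_or_pos n with rfl | hn
  · simp
  · have : (1 : ℝ) ≤ n := by exact_mod_cast hn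
    rw [← Real.rpow_add_natCast' hx (by linarith), sub_add_eq_add_sub]

theorem cornerDensity_mul_prod_pow {k : ℕ} {α : Fin (k + 1) → ℝ} (hα : ∀ i, 0 < α i)
    (m : Fin (k + 1) → ℕ) (z : Fin k → ℝ) :
    cornerDensity (fun i => α i.castSucc) (α (Fin.last k)) 1 z *
        ∏ i, (Fin.snoc z (1 - ∑ i, z i) : Fin (k + 1) → ℝ) i ^ m i =
      cornerDensity (fun i => α i.castSucc + m i.castSucc)
        (α (Fin.last k) + m (Fin.last k)) 1 z := by
  unfold cornerDensity
  split_ifs with h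
  · rw [← Real.rpow_sub_one_mul_pow (sub_nonneg.2 h.2) (hα _),
      Finset.prod_congr rfl fun i _ =>
        (Real.rpow_sub_one_mul_pow (h.1 i) (hα i.castSucc) (m i.castSucc)).symm,
      Finset.prod_mul_distrib, Fin.prod_univ_castSucc]
    simp only [Fin.snoc_castSucc, Fin.snoc_last]
    ring
  · simp

theorem ae_dirichlet_mem_Icc {k : ℕ} (α : Fin (k + 1) → ℝ) :
    ∀ᵐ y ∂(dirichlet α), ∀ i, y i ∈ Set.Icc (0 : ℝ) 1 := by
  rw [dirichlet_eq, ae_map_iff measurable_snoc_one_sub_sum.aemeasurable,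
    ae_withDensity_iff ((measurable_cornerDensity _ _ _).const_mul _).ennreal_ofReal]
  · refine .of_forall fun z hz i => ?_
    have h : (∀ i, 0 ≤ z i) ∧ ∑ i, z i ≤ 1 := by
      by_contra h
      exact hz (by simp [cornerDensity, if_neg h])
    refine Fin.lastCases ?_ (fun i => ?_) i
    · simp only [Fin.snoc_last]
      exact ⟨sub_nonneg.2 h.2, sub_le_self _ (Finset.sum_nonneg fun i _ => h.1 i)⟩
    · simp only [Fin.snoc_castSucc]
      exact ⟨h.1 i, (Finset.single_le_sum (fun i _ => h.1 i) (Finset.mem_univ i)).trans h.2⟩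
  · simp only [Set.ofPred_forall]
    exact MeasurableSet.iInter fun i => measurableSet_Icc.preimage (measurable_pi_apply i)

theorem lintegral_dirichlet_prod_pow {k : ℕ} {α : Fin (k + 1) → ℝ} (hα : ∀ i, 0 < α i)
    (m : Fin (k + 1) → ℕ) :
    ∫⁻ y, ENNReal.ofReal (∏ i, y i ^ m i) ∂(dirichlet α) =
      ENNReal.ofReal ((∏ i, (ascPochhammer ℝ (m i)).eval (α i)) /
        (ascPochhammer ℝ (∑ i, m i)).eval (∑ i, α i)) := by
  have hS : 0 < ∑ i, α i := Finset.sum_pos (fun i _ => hα i) Finset.univ_nonempty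
  have hP : 0 < ∏ i, Real.Gamma (α i) :=
    Finset.prod_pos fun i _ => Real.Gamma_pos_of_pos (hα i)
  have hΓ := Real.Gamma_pos_of_pos hS
  have hC : 0 ≤ Real.Gamma (∑ i, α i) / ∏ i, Real.Gamma (α i) := by positivity
  rw [dirichlet_eq, lintegral_map (by fun_prop) measurable_snoc_one_sub_sum,
    lintegral_withDensity_eq_lintegral_mul _
      ((measurable_cornerDensity _ _ _).const_mul _).ennreal_ofReal
      (by have := @measurable_snoc_one_sub_sum k; fun_prop)]
  simp only [Pi.mul_apply]
  have hpt : ∀ z : Fin k → ℝ, ENNReal.ofReal (Real.Gamma (∑ i, α i) / (∏ i, Real.Gamma (α i)) *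
        cornerDensity (fun i => α i.castSucc) (α (Fin.last k)) 1 z) *
      ENNReal.ofReal (∏ i, (Fin.snoc z (1 - ∑ i, z i) : Fin (k + 1) → ℝ) i ^ m i) =
      ENNReal.ofReal (Real.Gamma (∑ i, α i) / ∏ i, Real.Gamma (α i)) *
        ENNReal.ofReal (cornerDensity (fun i => α i.castSucc + m i.castSucc)
          (α (Fin.last k) + m (Fin.last k)) 1 z) := fun z => by
    rw [← ENNReal.ofReal_mul (mul_nonneg hC (cornerDensity_nonneg _ _ _ _)), mul_assoc,
      cornerDensity_mul_prod_pow hα, ENNReal.ofReal_mul hC]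
  simp only [hpt]
  rw [lintegral_const_mul _ (measurable_cornerDensity _ _ _).ennreal_ofReal,
    lintegral_cornerDensity (fun i => add_pos_of_pos_of_nonneg (hα _) (Nat.cast_nonneg _))
      (add_pos_of_pos_of_nonneg (hα _) (Nat.cast_nonneg _)) one_pos, ← ENNReal.ofReal_mul hC,
    ← Fin.prod_univ_castSucc (fun i => Real.Gamma (α i + m i)),
    ← Fin.sum_univ_castSucc (fun i => α i + (m i : ℝ)), Finset.sum_add_distrib, ← Nat.cast_sum,
    Real.Gamma_add_natCast_eq hS,
    Finset.prod_congr rfl fun i _ => Real.Gamma_add_natCast_eq (hα i) (m i),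
    Finset.prod_mul_distrib, Real.one_rpow]
  have := ascPochhammer_pos (∑ i, m i) _ hS
  congr 1
  field_simp

theorem isProbabilityMeasure_dirichlet {k : ℕ} {α : Fin (k + 1) → ℝ} (hα : ∀ i, 0 < α i) :
    IsProbabilityMeasure (dirichlet α) :=
  ⟨by simpa using lintegral_dirichlet_prod_pow hα 0⟩

/-- The mixed moments of the Dirichlet distribution. -/
theorem integral_dirichlet_prod_pow {k : ℕ} {α : Fin (k + 1) → ℝ} (hα : ∀ i, 0 < α i)
    (m : Fin (k + 1) → ℕ) :
    ∫ y, ∏ i, y i ^ m i ∂(dirichlet α) =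
      (∏ i, (ascPochhammer ℝ (m i)).eval (α i)) /
        (ascPochhammer ℝ (∑ i, m i)).eval (∑ i, α i) := by
  have hS : 0 < ∑ i, α i := Finset.sum_pos (fun i _ => hα i) Finset.univ_nonempty
  rw [integral_eq_lintegral_of_nonneg_ae, lintegral_dirichlet_prod_pow hα, ENNReal.toReal_ofReal]
  · exact div_nonneg (Finset.prod_nonneg fun i _ => (ascPochhammer_pos _ _ (hα i)).le)
      (ascPochhammer_pos _ _ hS).le
  · filter_upwards [ae_dirichlet_mem_Icc α] with y hy
    exact Finset.prod_nonneg fun i _ => pow_nonneg (hy i).1 _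
  · exact Measurable.aestronglyMeasurable (by fun_prop)

theorem ofReal_eval_ascPochhammer (n : ℕ) (x : ℝ) :
    (((ascPochhammer ℝ n).eval x : ℝ) : ℂ) = (ascPochhammer ℂ n).eval (x : ℂ) := by
  rw [← ascPochhammer_map Complex.ofRealHom]
  exact (Polynomial.eval_map_apply (f := Complex.ofRealHom) _).symm

theorem summable_norm_pow_div_factorial (x : ℂ) :
    Summable fun j : ℕ => ‖x ^ j / (j.factorial : ℂ)‖ := by
  simpa using Real.summable_pow_div_factorial ‖x‖

/-- The exponential of a sum, expanded over multi-indices. -/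
theorem hasSum_prod_pow_div_factorial {n : ℕ} (x : Fin n → ℂ) :
    HasSum (fun m : Fin n → ℕ => ∏ i, x i ^ m i / ((m i).factorial : ℂ))
      (Complex.exp (∑ i, x i)) := by
  have h := (hasSum_prod_fin fun i => summable_norm_pow_div_factorial (x i)).2
  rwa [Complex.exp_sum, Finset.prod_congr rfl fun i _ => by
    rw [Complex.exp_eq_exp_ℂ, NormedSpace.exp_eq_tsum_div]]

/-- The characteristic function of `Dir(α)`:
`∫ exp(i s·y) dDir(α)(y) = Σ_{m ∈ ℕ_0^k} ((α)_m/m!) · i^{|m|} s^m / (|α|)_{|m|}`,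
i.e. it equals the confluent Lauricella (Humbert) function `Φ₂[α; |α|; i s]`. -/
theorem dirichlet_charFun {k : ℕ} (α : Fin (k + 1) → ℝ) (hα : ∀ i, 0 < α i)
    (s : Fin (k + 1) → ℝ) :
    (∫ y, Complex.exp (Complex.I * (∑ i, s i * y i : ℝ)) ∂(dirichlet α))
      = ∑' m : Fin (k + 1) → ℕ,
          (∏ i, (ascPochhammer ℂ (m i)).eval (α i : ℂ)) / (∏ i, ((m i).factorial : ℂ)) *
            (Complex.I ^ (∑ i, m i) * ∏ i, (s i : ℂ) ^ m i) /
              (ascPochhammer ℂ (∑ i, m i)).eval ((∑ i, α i : ℝ) : ℂ) := by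
  have := isProbabilityMeasure_dirichlet hα
  have hexp : ∀ y : Fin (k + 1) → ℝ, Complex.exp (Complex.I * (∑ i, s i * y i : ℝ)) =
      Complex.exp (∑ i, Complex.I * s i * y i) := fun y => by
    push_cast [Finset.mul_sum, mul_assoc]
    rfl
  simp only [hexp]
  have key := hasSum_integral_of_dominated_convergence (μ := dirichlet α)
    (F := fun (m : Fin (k + 1) → ℕ) (y : Fin (k + 1) → ℝ) =>
      ∏ i, (Complex.I * s i * y i) ^ m i / ((m i).factorial : ℂ))
    (f := fun y => Complex.exp (∑ i, Complex.I * s i * y i))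
    (fun m _ => ‖∏ i, (s i : ℂ) ^ m i / ((m i).factorial : ℂ)‖)
    (fun m => Measurable.aestronglyMeasurable (by fun_prop))
    (fun m => by
      filter_upwards [ae_dirichlet_mem_Icc α] with y hy
      simp only [norm_prod, norm_div, norm_pow, norm_mul, Complex.norm_I, one_mul]
      gcongr with i
      refine mul_le_of_le_one_right (norm_nonneg _) ?_
      rw [Complex.norm_real, Real.norm_of_nonneg (hy i).1]
      exact (hy i).2)
    (.of_forall fun _ => (hasSum_prod_fin fun i => summable_norm_pow_div_factorial (s i : ℂ)).1)
    (integrable_const _)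
    (.of_forall fun y => hasSum_prod_pow_div_factorial _)
  rw [← key.tsum_eq]
  refine tsum_congr fun m => ?_
  have hsplit : ∀ y : Fin (k + 1) → ℝ,
      ∏ i, (Complex.I * s i * y i) ^ m i / ((m i).factorial : ℂ) =
      (Complex.I ^ (∑ i, m i) * ∏ i, (s i : ℂ) ^ m i) / (∏ i, ((m i).factorial : ℂ)) *
        ((∏ i, y i ^ m i : ℝ) : ℂ) := fun y => by
    simp only [Finset.prod_div_distrib, mul_pow, Finset.prod_mul_distrib, Finset.prod_pow_eq_pow_sum]
    push_cast
    ring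
  simp only [hsplit]
  rw [integral_const_mul, integral_complex_ofReal, integral_dirichlet_prod_pow hα]
  push_cast [ofReal_eval_ascPochhammer]
  ring
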